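/- arXiv:1309.1420 — 2 statements merged into one kernel-verified Lean document; each statement's English description precedes it below -/
import Mathlib

section
/- With the backward recursion K̃*_t := K*_t ∩ cl(conv(Γ_t)) and Λ_t(ω) := {x ∈ ℝ^d : x ∈ K̃_{t+1}(ω,·) 𝒫_t(ω)-q.s.}, the following hold for each t and ω: (i) K̃*_t(ω) = K*_t(ω) ∩ Λ_t(ω)*; (ii) K̃_t(ω) = cl(K_t(ω) + Λ_t(ω)), and if int K̃*_t(ω) ≠ ∅ then K̃_t(ω) = K_t(ω) + Λ_t(ω), where + is the Minkowski sum. -/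
open MeasureTheory Set
open scoped ENNReal Pointwise

noncomputable section

/-- Convexity for a set of probability measures. -/
def ConvexProb {α : Type*} [MeasurableSpace α] (𝒬 : Set (ProbabilityMeasure α)) : Prop :=
  ∀ P ∈ 𝒬, ∀ Q ∈ 𝒬, ∀ a b : ℝ≥0∞, a + b = 1 → ∀ R : ProbabilityMeasure α,
    (R : Measure α) = a • (P : Measure α) + b • (Q : Measure α) → R ∈ 𝒬

/-- The dual cone of a set in `ℝ^d`. -/
def dualCone {d : ℕ} (C : Set (Fin d → ℝ)) : Set (Fin d → ℝ) :=
  {y | ∀ x ∈ C, 0 ≤ ∑ i, x i * y i}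

/-- The support of a set-valued map under a family of probability measures: the smallest closed
set `F ⊆ ℝ^d` such that `P(C(·) ⊆ F) = 1` for every member `P` of the family. -/
def svSupport {α : Type*} [MeasurableSpace α] {d : ℕ} (𝒬 : Set (ProbabilityMeasure α))
    (C : α → Set (Fin d → ℝ)) : Set (Fin d → ℝ) :=
  ⋂₀ {F : Set (Fin d → ℝ) | IsClosed F ∧ ∀ P ∈ 𝒬, (P : Measure α) {x | C x ⊆ F} = 1}

/-- `Λ_t(ω)`: the vectors lying in the cone `K̃_{t+1}(ω,·) = (K̃*_{t+1}(ω,·))*`,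
`𝒫_t(ω)`-quasi-surely. -/
def LambdaSet {Ω₁ : Type*} [MeasurableSpace Ω₁] {t d : ℕ}
    (𝒬t : (Fin t → Ω₁) → Set (ProbabilityMeasure Ω₁))
    (Kt1star : (Fin t → Ω₁) × Ω₁ → Set (Fin d → ℝ)) (ω : Fin t → Ω₁) : Set (Fin d → ℝ) :=
  {x | ∀ P ∈ 𝒬t ω, ∀ᵐ ω' ∂(P : Measure Ω₁), x ∈ dualCone (Kt1star (ω, ω'))}

/-- `Γ_t(ω) := supp_{𝒫_t(ω)} K̃*_{t+1}(ω, ·)`. -/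
def GammaSet {Ω₁ : Type*} [MeasurableSpace Ω₁] {t d : ℕ}
    (𝒬t : (Fin t → Ω₁) → Set (ProbabilityMeasure Ω₁))
    (Kt1star : (Fin t → Ω₁) × Ω₁ → Set (Fin d → ℝ)) (ω : Fin t → Ω₁) : Set (Fin d → ℝ) :=
  svSupport (𝒬t ω) (fun ω' => Kt1star (ω, ω'))

section AnalyticCapacity

theorem isCompact_setOf_forall_le (n : ℕ → ℕ) : IsCompact {x : ℕ → ℕ | ∀ i, x i ≤ n i} := by
  have h := isCompact_univ_pi fun i => (Set.finite_Iic (n i)).isCompact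
  convert h using 1
  ext x
  simp [Pi.le_def]

/-- An open neighbourhood of `{x | ∀ i, x i ≤ n i}` in Baire space contains all the sequences that
are bounded by `n` in a sufficiently long initial segment. -/
theorem exists_forall_lt_le_subset_of_isOpen {n : ℕ → ℕ} {V : Set (ℕ → ℕ)} (hV : IsOpen V)
    (hnV : {x : ℕ → ℕ | ∀ i, x i ≤ n i} ⊆ V) :
    ∃ k, {x : ℕ → ℕ | ∀ i < k, x i ≤ n i} ⊆ V := by
  have hcomp : IsCompact {x : ℕ → ℕ | ∀ i, x i ≤ n i} := isCompact_setOf_forall_le n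
  have hcyl : ∀ x : ℕ → ℕ, ∃ k, x ∈ V → PiNat.cylinder x k ⊆ V := by
    intro x
    by_cases hx : x ∈ V
    · obtain ⟨_, ⟨z, k, rfl⟩, hxz, hzV⟩ :=
        (PiNat.isTopologicalBasis_cylinders (fun _ : ℕ => ℕ)).exists_subset_of_mem_open hx hV
      refine ⟨k, fun _ => ?_⟩
      rwa [PiNat.mem_cylinder_iff_eq.1 hxz]
    · exact ⟨0, fun h => absurd h hx⟩
  choose k hk using hcyl
  obtain ⟨t, htn, htcov⟩ := hcomp.elim_nhds_subcover (fun x => PiNat.cylinder x (k x))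
    fun x _ => (PiNat.isOpen_cylinder _ x (k x)).mem_nhds (PiNat.self_mem_cylinder x _)
  refine ⟨t.sup k, fun z hz => ?_⟩
  have hz' : (fun i => min (z i) (n i)) ∈ {x : ℕ → ℕ | ∀ i, x i ≤ n i} :=
    fun i => min_le_right _ _
  obtain ⟨x, hxt, hx⟩ := mem_iUnion₂.1 (htcov hz')
  refine hk x (hnV (htn x hxt)) (PiNat.mem_cylinder_iff.2 fun i hi => ?_)
  rw [← PiNat.mem_cylinder_iff.1 hx i hi]
  exact (min_eq_left (hz i (hi.trans_le (Finset.le_sup hxt)))).symm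

variable {α : Type*} [TopologicalSpace α] [MeasurableSpace α]

/-- **Capacitability of analytic sets**: an analytic set is approximated from inside by compact
sets, for its outer measure. -/
theorem MeasureTheory.AnalyticSet.exists_isCompact_le_measure {A : Set α} (hA : AnalyticSet A)
    (μ : Measure α) [μ.OuterRegular] {r : ℝ≥0∞} (hr : r < μ A) :
    ∃ C ⊆ A, IsCompact C ∧ r ≤ μ C := by
  rw [AnalyticSet] at hA
  obtain rfl | ⟨f, hf, rfl⟩ := hA
  · simp at hr
  have step : ∀ (k : ℕ) (S : Set (ℕ → ℕ)), ∃ m : ℕ,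
      r < μ (f '' S) → r < μ (f '' (S ∩ {x | x k ≤ m})) := by
    intro k S
    by_cases hS : r < μ (f '' S)
    · have hU : f '' S = ⋃ m : ℕ, f '' (S ∩ {x | x k ≤ m}) := by
        rw [← image_iUnion, ← inter_iUnion]
        congr 1
        refine (inter_eq_left.2 fun x _ => mem_iUnion.2 ⟨x k, ?_⟩).symm
        simp
      have hmono : Monotone fun m : ℕ => f '' (S ∩ {x | x k ≤ m}) := fun a b hab =>
        image_mono (inter_subset_inter_right _ fun x (hx : x k ≤ a) => hx.trans hab)
      rw [hU, hmono.measure_iUnion] at hS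
      obtain ⟨m, hm⟩ := lt_iSup_iff.1 hS
      exact ⟨m, fun _ => hm⟩
    · exact ⟨0, fun h => absurd h hS⟩
  choose m hm using step
  let S : ℕ → Set (ℕ → ℕ) := fun k => Nat.rec univ (fun k S => S ∩ {x | x k ≤ m k S}) k
  have hS : ∀ k, S k = {x | ∀ i < k, x i ≤ m i (S i)} := by
    intro k
    induction k with
    | zero => simp [S]
    | succ k ih =>
      have hsucc : S (k + 1) = S k ∩ {x | x k ≤ m k (S k)} := rfl
      rw [hsucc]
      ext x
      constructor
      · rintro ⟨hx, hxk⟩ i hi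
        rw [ih] at hx
        rcases Nat.lt_succ_iff_lt_or_eq.1 hi with h | rfl
        · exact hx i h
        · exact hxk
      · intro hx
        refine ⟨?_, hx k k.lt_succ_self⟩
        rw [ih]
        exact fun i hi => hx i (hi.trans k.lt_succ_self)
  have hSr : ∀ k, r < μ (f '' S k) := by
    intro k
    induction k with
    | zero => simpa [S] using hr
    | succ k ih => exact hm k _ ih
  have hcomp : IsCompact {x : ℕ → ℕ | ∀ i, x i ≤ m i (S i)} := isCompact_setOf_forall_le _
  refine ⟨f '' {x | ∀ i, x i ≤ m i (S i)}, image_subset_range _ _, hcomp.image hf, ?_⟩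
  rw [Set.measure_eq_iInf_isOpen _ μ]
  refine le_iInf₂ fun U hU => le_iInf fun hUo => ?_
  obtain ⟨k, hk⟩ := exists_forall_lt_le_subset_of_isOpen (hUo.preimage hf) (image_subset_iff.1 hU)
  exact (hSr k).le.trans (measure_mono (image_subset_iff.2 (by rwa [hS k])))

/-- An analytic set whose complement has full outer measure is null. -/
theorem MeasureTheory.AnalyticSet.measure_eq_zero_of_compl [T2Space α] [OpensMeasurableSpace α]
    {A : Set α} (hA : AnalyticSet A) (μ : Measure α) [IsProbabilityMeasure μ] [μ.OuterRegular]
    (h : μ Aᶜ = 1) : μ A = 0 := by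
  by_contra h0
  obtain ⟨r, hr0, hr⟩ := exists_between (pos_iff_ne_zero.2 h0)
  obtain ⟨C, hCA, hC, hrC⟩ := hA.exists_isCompact_le_measure μ hr
  have h1 : μ Cᶜ = 1 := le_antisymm prob_le_one (h ▸ measure_mono (compl_subset_compl.2 hCA))
  rw [prob_compl_eq_one_iff hC.isClosed.measurableSet] at h1
  rw [h1] at hrC
  exact absurd hrC hr0.not_ge

end AnalyticCapacity

section DualCone

variable {d : ℕ}

theorem subset_dualCone_comm {C D : Set (Fin d → ℝ)} : C ⊆ dualCone D ↔ D ⊆ dualCone C := by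
  constructor <;> intro h x hx y hy
  · simpa [mul_comm] using h hy x hx
  · simpa [mul_comm] using h hy x hx

theorem dualCone_anti {C D : Set (Fin d → ℝ)} (h : C ⊆ D) : dualCone D ⊆ dualCone C :=
  fun _ hy x hx => hy x (h hx)

theorem isClosed_dualCone (C : Set (Fin d → ℝ)) : IsClosed (dualCone C) := by
  have h : dualCone C = ⋂ x ∈ C, {y | 0 ≤ ∑ i, x i * y i} := by
    ext y
    simp [dualCone]
  rw [h]
  exact isClosed_biInter fun x _ => isClosed_le continuous_const (by fun_prop)

theorem convex_dualCone (C : Set (Fin d → ℝ)) : Convex ℝ (dualCone C) := by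
  intro y hy z hz a b ha hb _ x hx
  have h : ∑ i, x i * (a • y + b • z) i = a * ∑ i, x i * y i + b * ∑ i, x i * z i := by
    rw [Finset.mul_sum, Finset.mul_sum, ← Finset.sum_add_distrib]
    refine Finset.sum_congr rfl fun i _ => ?_
    simp only [Pi.add_apply, Pi.smul_apply, smul_eq_mul]
    ring
  rw [h]
  exact add_nonneg (mul_nonneg ha (hy x hx)) (mul_nonneg hb (hz x hx))

theorem zero_mem_dualCone (C : Set (Fin d → ℝ)) : (0 : Fin d → ℝ) ∈ dualCone C := by
  intro x _
  simp

theorem smul_mem_dualCone {C : Set (Fin d → ℝ)} {c : ℝ} (hc : 0 ≤ c) {y : Fin d → ℝ}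
    (hy : y ∈ dualCone C) : c • y ∈ dualCone C := by
  intro x hx
  have h : ∑ i, x i * (c • y) i = c * ∑ i, x i * y i := by
    rw [Finset.mul_sum]
    refine Finset.sum_congr rfl fun i _ => ?_
    simp only [Pi.smul_apply, smul_eq_mul]
    ring
  rw [h]
  exact mul_nonneg hc (hy x hx)

theorem closure_convexHull_subset_dualCone {C D : Set (Fin d → ℝ)} (h : C ⊆ dualCone D) :
    closure (convexHull ℝ C) ⊆ dualCone D :=
  closure_minimal (convexHull_min h (convex_dualCone D)) (isClosed_dualCone D)

theorem dualCone_closure_convexHull (C : Set (Fin d → ℝ)) :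
    dualCone (closure (convexHull ℝ C)) = dualCone C :=
  Subset.antisymm (dualCone_anti ((subset_convexHull ℝ C).trans subset_closure))
    (subset_dualCone_comm.1 (closure_convexHull_subset_dualCone (subset_dualCone_comm.1 subset_rfl)))

/-- **Bipolar theorem**: a subset of `ℝ^d` containing `0` and stable under positive scaling has the
closure of its convex hull as bidual cone. -/
theorem dualCone_dualCone {C : Set (Fin d → ℝ)} (h0 : (0 : Fin d → ℝ) ∈ C)
    (hC : ∀ c : ℝ, 0 < c → ∀ x ∈ C, c • x ∈ C) :
    dualCone (dualCone C) = closure (convexHull ℝ C) := by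
  refine Subset.antisymm (fun x hx => ?_)
    (closure_convexHull_subset_dualCone (subset_dualCone_comm.1 subset_rfl))
  by_contra hxC
  obtain ⟨f, u, hfu, hux⟩ := geometric_hahn_banach_closed_point
    (convex_convexHull ℝ C).closure isClosed_closure hxC
  have hfC : ∀ a ∈ C, f a < u := fun a ha => hfu a (subset_closure (subset_convexHull ℝ C ha))
  have hu : 0 < u := by simpa using hfC 0 h0
  have hf : ∀ a ∈ C, f a ≤ 0 := by
    intro a ha
    by_contra! hpos
    have h := hfC _ (hC (u / f a) (div_pos hu hpos) a ha)
    rw [map_smul, smul_eq_mul, div_mul_cancel₀ _ hpos.ne'] at h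
    exact lt_irrefl _ h
  have hsum : ∀ a : Fin d → ℝ, f a = ∑ i, a i * f (Pi.single i 1) := by
    intro a
    conv_lhs => rw [← Finset.univ_sum_single a]
    rw [map_sum]
    refine Finset.sum_congr rfl fun i _ => ?_
    rw [← smul_eq_mul, ← map_smul, ← Pi.single_smul]
    simp
  have hy : (fun i => -f (Pi.single i 1)) ∈ dualCone C := by
    intro a ha
    have h := hf a ha
    rw [hsum] at h
    simpa using h
  have h := hx _ hy
  have hfx : f x ≤ 0 := by
    rw [hsum]
    simpa [mul_comm] using h
  linarith

theorem dualCone_add {C D : Set (Fin d → ℝ)} (hC : (0 : Fin d → ℝ) ∈ C)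
    (hD : (0 : Fin d → ℝ) ∈ D) : dualCone (C + D) = dualCone C ∩ dualCone D := by
  refine Subset.antisymm (fun y hy => ⟨fun x hx => ?_, fun x hx => ?_⟩) ?_
  · simpa using hy (x + 0) (add_mem_add hx hD)
  · simpa using hy (0 + x) (add_mem_add hC hx)
  · rintro y ⟨hyC, hyD⟩ _ ⟨a, ha, b, hb, rfl⟩
    simp only [Pi.add_apply, add_mul, Finset.sum_add_distrib]
    exact add_nonneg (hyC a ha) (hyD b hb)

/-- If `y` is interior to the dual cone of `C`, then `⟨·, y⟩` dominates a multiple of the norm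
on `C`. -/
theorem exists_mul_norm_le_of_mem_interior_dualCone {C : Set (Fin d → ℝ)} {y : Fin d → ℝ}
    (hy : y ∈ interior (dualCone C)) :
    ∃ ε > 0, ∀ x ∈ C, ε * ‖x‖ ≤ ∑ i, x i * y i := by
  obtain ⟨ε, hε, hball⟩ := Metric.nhds_basis_closedBall.mem_iff.1 (mem_interior_iff_mem_nhds.1 hy)
  refine ⟨ε, hε, fun x hx => ?_⟩
  have key : ∀ (i : Fin d) (s : ℝ), |s| ≤ ε → x i * s ≤ ∑ j, x j * y j := by
    intro i s hs
    have hmem : y - Pi.single i s ∈ Metric.closedBall y ε := by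
      rw [Metric.mem_closedBall, dist_eq_norm, sub_sub_cancel_left, norm_neg, Pi.norm_single]
      exact hs
    have h := hball hmem x hx
    simp only [Pi.sub_apply, mul_sub, Finset.sum_sub_distrib, Pi.single_apply, mul_ite, mul_zero,
      Finset.sum_ite_eq', Finset.mem_univ, if_true] at h
    linarith
  have hnonneg : 0 ≤ ∑ j, x j * y j := interior_subset hy x hx
  rw [mul_comm, ← le_div_iff₀ hε, pi_norm_le_iff_of_nonneg (div_nonneg hnonneg hε.le)]
  intro i
  rw [le_div_iff₀ hε, Real.norm_eq_abs]
  rcases abs_cases (x i) with ⟨h, _⟩ | ⟨h, _⟩ <;> rw [h]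
  · exact key i ε (abs_of_pos hε).le
  · simpa using key i (-ε) (by rw [abs_neg, abs_of_pos hε])

/-- The Minkowski sum of closed sets whose dual cones have a common interior point is closed. -/
theorem isClosed_add_of_interior_dualCone {C D : Set (Fin d → ℝ)} (hC : IsClosed C)
    (hD : IsClosed D) (hint : (interior (dualCone C ∩ dualCone D)).Nonempty) :
    IsClosed (C + D) := by
  obtain ⟨y, hy⟩ := hint
  rw [interior_inter] at hy
  obtain ⟨ε, hε, hbound⟩ := exists_mul_norm_le_of_mem_interior_dualCone hy.1
  refine isClosed_of_closure_subset fun z hz => ?_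
  set M : ℝ := ∑ i, z i * y i + 1 with hM
  have hopen : IsOpen {w : Fin d → ℝ | ∑ i, w i * y i < M} :=
    isOpen_lt (by fun_prop) continuous_const
  have hzM : z ∈ {w : Fin d → ℝ | ∑ i, w i * y i < M} := by
    simp only [Set.mem_ofPred_eq, hM]
    linarith
  have hcl : IsClosed (C ∩ Metric.closedBall 0 (M / ε) + D) :=
    hD.add_left_of_isCompact ((isCompact_closedBall _ _).inter_left hC)
  have hsub : {w : Fin d → ℝ | ∑ i, w i * y i < M} ∩ (C + D) ⊆
      C ∩ Metric.closedBall 0 (M / ε) + D := by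
    rintro _ ⟨hw, a, ha, b, hb, rfl⟩
    refine add_mem_add ⟨ha, ?_⟩ hb
    simp only [Set.mem_ofPred_eq, Pi.add_apply, add_mul, Finset.sum_add_distrib] at hw
    have h1 := hbound a ha
    have h2 := interior_subset hy.2 b hb
    rw [mem_closedBall_zero_iff, le_div_iff₀ hε]
    linarith
  exact add_subset_add_right inter_subset_left
    (closure_minimal hsub hcl (hopen.inter_closure ⟨hzM, hz⟩))

theorem add_smul_mem_of_cone {C D : Set (Fin d → ℝ)} {c : ℝ} (hC : ∀ x ∈ C, c • x ∈ C)
    (hD : ∀ x ∈ D, c • x ∈ D) : ∀ x ∈ C + D, c • x ∈ C + D := by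
  rintro _ ⟨a, ha, b, hb, rfl⟩
  exact ⟨c • a, hC a ha, c • b, hD b hb, (smul_add c a b).symm⟩

end DualCone

section Support

variable {α : Type*} [MeasurableSpace α] {d : ℕ}

theorem isClosed_svSupport (𝒬 : Set (ProbabilityMeasure α)) (C : α → Set (Fin d → ℝ)) :
    IsClosed (svSupport 𝒬 C) :=
  isClosed_sInter fun _ hF => hF.1

theorem svSupport_subset_of_ae {𝒬 : Set (ProbabilityMeasure α)} {C : α → Set (Fin d → ℝ)}
    {F : Set (Fin d → ℝ)} (hF : IsClosed F)
    (h : ∀ P ∈ 𝒬, ∀ᵐ x ∂(P : Measure α), C x ⊆ F) : svSupport 𝒬 C ⊆ F := by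
  refine sInter_subset_of_mem ⟨hF, fun P hP => ?_⟩
  have huniv : {x | C x ⊆ F} =ᵐ[(P : Measure α)] univ := Filter.eventuallyEq_univ.2 (h P hP)
  rw [measure_congr huniv, measure_univ]

/-- The support of a set-valued map with analytic graph contains almost all of its values. -/
theorem ae_subset_svSupport [TopologicalSpace α] [PolishSpace α] [BorelSpace α]
    {𝒬 : Set (ProbabilityMeasure α)} {C : α → Set (Fin d → ℝ)}
    (hC : AnalyticSet {q : α × (Fin d → ℝ) | q.2 ∈ C q.1}) {P : ProbabilityMeasure α}
    (hP : P ∈ 𝒬) : ∀ᵐ x ∂(P : Measure α), C x ⊆ svSupport 𝒬 C := by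
  have hae : ∀ F : Set (Fin d → ℝ), IsClosed F → (P : Measure α) {x | C x ⊆ F} = 1 →
      ∀ᵐ x ∂(P : Measure α), C x ⊆ F := by
    intro F hF h1
    have hFc : AnalyticSet (Prod.snd ⁻¹' Fᶜ : Set (α × (Fin d → ℝ))) := by
      have ho : IsOpen (Prod.snd ⁻¹' Fᶜ : Set (α × (Fin d → ℝ))) :=
        hF.isOpen_compl.preimage continuous_snd
      simpa using ho.analyticSet_image continuous_id
    have hinter : AnalyticSet ({q : α × (Fin d → ℝ) | q.2 ∈ C q.1} ∩ Prod.snd ⁻¹' Fᶜ) := by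
      rw [inter_eq_iInter]
      exact AnalyticSet.iInter fun b => by cases b <;> assumption
    have himage := hinter.image_of_continuous continuous_fst
    have heq : Prod.fst '' ({q : α × (Fin d → ℝ) | q.2 ∈ C q.1} ∩ Prod.snd ⁻¹' Fᶜ) =
        {x | C x ⊆ F}ᶜ := by
      ext x
      simp [Set.not_subset]
    rw [heq] at himage
    exact himage.measure_eq_zero_of_compl (P : Measure α) (by rwa [compl_compl])
  set 𝒮 : Set (Set (Fin d → ℝ)) :=
    {F | IsClosed F ∧ ∀ P ∈ 𝒬, (P : Measure α) {x | C x ⊆ F} = 1} with h𝒮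
  obtain ⟨T, hTc, hT𝒮, hTU⟩ := TopologicalSpace.isOpen_sUnion_countable (compl '' 𝒮) (by
    rintro _ ⟨F, hF, rfl⟩
    exact hF.1.isOpen_compl)
  have hall : ∀ᵐ x ∂(P : Measure α), ∀ U ∈ T, C x ⊆ Uᶜ := by
    refine (ae_ball_iff hTc).2 fun U hU => ?_
    obtain ⟨F, hF, rfl⟩ := hT𝒮 hU
    rw [compl_compl]
    exact hae F hF.1 (hF.2 P hP)
  filter_upwards [hall] with x hx
  have hsupp : svSupport 𝒬 C = (⋃₀ T)ᶜ := by
    rw [hTU, compl_sUnion, ← image_comp]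
    simp [svSupport, h𝒮]
  rw [hsupp]
  rintro y hy ⟨U, hU, hyU⟩
  exact hx U hU hy hyU

end Support

/-- Proposition 5.9: with `K̃*_t = K*_t ∩ cl conv Γ_t`, one has
(i) `K̃*_t = K*_t ∩ Λ_t*`, and (ii) `K̃_t = cl(K_t + Λ_t)`, with the closure superfluous when
`int K̃*_t ≠ ∅`. -/
theorem backward_recursion_dual_description {Ω₁ : Type*} [TopologicalSpace Ω₁] [PolishSpace Ω₁]
    [MeasurableSpace Ω₁] [BorelSpace Ω₁] (t d : ℕ)
    (𝒬t : (Fin t → Ω₁) → Set (ProbabilityMeasure Ω₁))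
    (h𝒬ne : ∀ ω, (𝒬t ω).Nonempty) (h𝒬conv : ∀ ω, ConvexProb (𝒬t ω))
    (h𝒬graph : AnalyticSet {p : (Fin t → Ω₁) × ProbabilityMeasure Ω₁ | p.2 ∈ 𝒬t p.1})
    (K : (Fin t → Ω₁) → Set (Fin d → ℝ))
    (hKcl : ∀ ω, IsClosed (K ω)) (hKconv : ∀ ω, Convex ℝ (K ω))
    (hKcone : ∀ ω, ∀ c : ℝ, 0 ≤ c → ∀ x ∈ K ω, c • x ∈ K ω)
    (hKorth : ∀ ω, {x : Fin d → ℝ | ∀ i, 0 ≤ x i} ⊆ K ω)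
    (hKgraph : AnalyticSet {p : (Fin t → Ω₁) × (Fin d → ℝ) | p.2 ∈ dualCone (K p.1)})
    (Kt1star : (Fin t → Ω₁) × Ω₁ → Set (Fin d → ℝ))
    (hne : ∀ p, (Kt1star p).Nonempty) (hcl : ∀ p, IsClosed (Kt1star p))
    (hconv : ∀ p, Convex ℝ (Kt1star p))
    (hcone : ∀ p, ∀ c : ℝ, 0 ≤ c → ∀ x ∈ Kt1star p, c • x ∈ Kt1star p)
    (hgraph : AnalyticSet {q : ((Fin t → Ω₁) × Ω₁) × (Fin d → ℝ) | q.2 ∈ Kt1star q.1}) :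
    ∀ ω,
      dualCone (K ω) ∩ closure (convexHull ℝ (GammaSet 𝒬t Kt1star ω)) =
          dualCone (K ω) ∩ dualCone (LambdaSet 𝒬t Kt1star ω) ∧
      dualCone (dualCone (K ω) ∩ closure (convexHull ℝ (GammaSet 𝒬t Kt1star ω))) =
          closure (K ω + LambdaSet 𝒬t Kt1star ω) ∧
      ((interior (dualCone (K ω) ∩
          closure (convexHull ℝ (GammaSet 𝒬t Kt1star ω)))).Nonempty →
        dualCone (dualCone (K ω) ∩ closure (convexHull ℝ (GammaSet 𝒬t Kt1star ω))) =
          K ω + LambdaSet 𝒬t Kt1star ω) := by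
  intro ω
  set Γ := GammaSet 𝒬t Kt1star ω with hΓ
  set Λ := LambdaSet 𝒬t Kt1star ω with hΛ
  have hsection : AnalyticSet {q : Ω₁ × (Fin d → ℝ) | q.2 ∈ Kt1star (ω, q.1)} :=
    hgraph.preimage (f := fun q : Ω₁ × (Fin d → ℝ) => ((ω, q.1), q.2)) (by fun_prop)
  have hΓae : ∀ P ∈ 𝒬t ω, ∀ᵐ ω' ∂(P : Measure Ω₁), Kt1star (ω, ω') ⊆ Γ := fun P hP =>
    ae_subset_svSupport hsection hP
  have hΛΓ : Λ = dualCone Γ := by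
    refine Subset.antisymm (fun x hx => ?_) (fun x hx P hP => ?_)
    · have hsub : Γ ⊆ dualCone {x} := by
        refine svSupport_subset_of_ae (isClosed_dualCone _) fun P hP => ?_
        filter_upwards [hx P hP] with ω' hω'
        exact subset_dualCone_comm.1 (singleton_subset_iff.2 hω')
      exact singleton_subset_iff.1 (subset_dualCone_comm.1 hsub)
    · filter_upwards [hΓae P hP] with ω' hω'
      exact dualCone_anti hω' hx
  have hΓ0 : (0 : Fin d → ℝ) ∈ Γ := by
    obtain ⟨P, hP⟩ := h𝒬ne ω
    obtain ⟨ω', hω'⟩ := (hΓae P hP).exists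
    obtain ⟨x, hx⟩ := hne (ω, ω')
    exact hω' (by simpa using hcone _ 0 le_rfl x hx)
  have hΓsmul : ∀ c : ℝ, 0 < c → ∀ x ∈ Γ, c • x ∈ Γ := by
    intro c hc
    have hclosed : IsClosed ((fun x : Fin d → ℝ => c • x) ⁻¹' Γ) :=
      (isClosed_svSupport _ _).preimage (continuous_const_smul c)
    refine svSupport_subset_of_ae hclosed fun P hP => ?_
    filter_upwards [hΓae P hP] with ω' hω' x hx
    exact hω' (hcone _ c hc.le x hx)
  have hL : closure (convexHull ℝ Γ) = dualCone Λ := by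
    rw [hΛΓ, dualCone_dualCone hΓ0 hΓsmul]
  have hK0 : (0 : Fin d → ℝ) ∈ K ω := hKorth ω fun _ => le_rfl
  have hΛ0 : (0 : Fin d → ℝ) ∈ Λ := hΛΓ ▸ zero_mem_dualCone Γ
  have hΛclosed : IsClosed Λ := hΛΓ ▸ isClosed_dualCone Γ
  have hΛconv : Convex ℝ Λ := hΛΓ ▸ convex_dualCone Γ
  have hΛsmul : ∀ c : ℝ, 0 < c → ∀ x ∈ Λ, c • x ∈ Λ := by
    intro c hc x hx
    rw [hΛΓ] at hx ⊢
    exact smul_mem_dualCone hc.le hx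
  have hdual : dualCone (dualCone (K ω) ∩ dualCone Λ) = closure (K ω + Λ) := by
    rw [← dualCone_add hK0 hΛ0, dualCone_dualCone (C := K ω + Λ) ⟨0, hK0, 0, hΛ0, add_zero 0⟩ fun c hc =>
        add_smul_mem_of_cone (hKcone ω c hc.le) (hΛsmul c hc),
      ((hKconv ω).add hΛconv).convexHull_eq]
  rw [hL]
  refine ⟨rfl, hdual, fun hint => ?_⟩
  rw [hdual, (isClosed_add_of_interior_dualCone (hKcl ω) hΛclosed hint).closure_eq]
end
end

section
/- Let t ∈ {0,…,T−1} and let P(·) : Ω_t → 𝔓(Ω₁) and Z_t(·) : Ω_t → ℝ^d be Borel. Define Ξ_t(ω) := {(Q, μ, P̂) ∈ 𝔓(Ω₁)^{1+d} × 𝒫_t(ω) : P(ω) ≪ Q ∼ μ ≪ P̂ and Z_t(ω)·(dμ/dQ)(·) ∈ int K̃*_{t+1}(ω,·) Q-a.s.}, where μ = (μ¹,…,μ^d), Q ∼ μ means Q ∼ μ^i for all i, μ ≪ P̂ means μ^i ≪ P̂ for all i, and Z_t(ω)·(dμ/dQ) denotes the componentwise product (Z_t^i(ω) dμ^i/dQ)_{i=1,…,d}.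 Then Ξ_t has an analytic graph and admits universally measurable selectors Q(·), μ(·), P̂(·) on the universally measurable set {Ξ_t ≠ ∅}. -/
open MeasureTheory Set
open scoped ENNReal

noncomputable section

/-- The universal completion of the σ-algebra on `α`. -/
def univComp (α : Type*) [MeasurableSpace α] : MeasurableSpace α where
  MeasurableSet' s := ∀ μ : Measure α, IsProbabilityMeasure μ → NullMeasurableSet s μ
  measurableSet_empty := fun _ _ => MeasurableSet.empty.nullMeasurableSet
  measurableSet_compl := fun _ hs μ hμ => (hs μ hμ).compl
  measurableSet_iUnion := fun _ hf μ hμ => NullMeasurableSet.iUnion fun i => hf i μ hμ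

/-- A universally measurable set. -/
def UnivMeasurableSet {α : Type*} [MeasurableSpace α] (s : Set α) : Prop :=
  MeasurableSet[univComp α] s

/-- A universally measurable function. -/
def UnivMeasurable {α β : Type*} [MeasurableSpace α] [MeasurableSpace β] (f : α → β) : Prop :=
  Measurable[univComp α] f

/-- The set-valued map `Ξ_t` of Lemma 5.13: tuples `(Q, μ, P̂)` with
`P(ω) ≪ Q ∼ μ ≪ P̂ ∈ 𝒫_t(ω)` and `Z_t(ω)·(dμ/dQ)(·) ∈ int K̃*_{t+1}(ω,·)` `Q`-a.s. -/
def XiSCPS {Ω₁ : Type*} [MeasurableSpace Ω₁] {t d : ℕ}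
    (𝒬t : (Fin t → Ω₁) → Set (ProbabilityMeasure Ω₁))
    (Pker : (Fin t → Ω₁) → ProbabilityMeasure Ω₁)
    (Z : (Fin t → Ω₁) → Fin d → ℝ)
    (Kt1star : (Fin t → Ω₁) × Ω₁ → Set (Fin d → ℝ)) (ω : Fin t → Ω₁) :
    Set (ProbabilityMeasure Ω₁ × (Fin d → ProbabilityMeasure Ω₁) × ProbabilityMeasure Ω₁) :=
  {q | q.2.2 ∈ 𝒬t ω ∧
    (Pker ω : Measure Ω₁) ≪ (q.1 : Measure Ω₁) ∧
    (∀ i, (q.1 : Measure Ω₁) ≪ (q.2.1 i : Measure Ω₁) ∧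
      (q.2.1 i : Measure Ω₁) ≪ (q.1 : Measure Ω₁)) ∧
    (∀ i, (q.2.1 i : Measure Ω₁) ≪ (q.2.2 : Measure Ω₁)) ∧
    ∀ᵐ ω' ∂(q.1 : Measure Ω₁),
      (fun i => Z ω i * ((q.2.1 i : Measure Ω₁).rnDeriv (q.1 : Measure Ω₁) ω').toReal)
        ∈ interior (Kt1star (ω, ω'))}

section Suslin

open Filter Topology ProbabilityTheory

/-- The continuous image of Baire space is approximated from inside by images of compact sets. -/
theorem exists_isCompact_le_measure_image {X : Type*} [TopologicalSpace X] [MeasurableSpace X]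
    (μ : Measure X) [μ.OuterRegular] {f : (ℕ → ℕ) → X} (hf : Continuous f) {c : ℝ≥0∞}
    (hc : c < μ (range f)) : ∃ K : Set (ℕ → ℕ), IsCompact K ∧ c ≤ μ (f '' K) := by
  have step : ∀ (k : ℕ) (C : Set (ℕ → ℕ)), c < μ (f '' C) →
      ∃ n, c < μ (f '' (C ∩ {z | z k ≤ n})) := by
    intro k C hC
    have hU : f '' C = ⋃ n, f '' (C ∩ {z | z k ≤ n}) := by
      rw [← image_iUnion, ← inter_iUnion]
      congr 1
      refine (inter_eq_left.2 fun z _ => mem_iUnion.2 ⟨z k, ?_⟩).symm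
      exact le_refl (z k)
    have hmono : Monotone fun n => f '' (C ∩ {z | z k ≤ n}) := fun m n hmn =>
      image_mono (inter_subset_inter_right _ fun z hz => le_trans (mem_ofPred.1 hz) hmn)
    rw [hU, hmono.measure_iUnion] at hC
    exact lt_iSup_iff.1 hC
  choose N hN using step
  let S : ℕ → {C : Set (ℕ → ℕ) // c < μ (f '' C)} := fun k =>
    Nat.rec ⟨univ, by rwa [image_univ]⟩
      (fun k C => ⟨C.1 ∩ {z | z k ≤ N k C.1 C.2}, hN k C.1 C.2⟩) k
  let n : ℕ → ℕ := fun k => N k (S k).1 (S k).2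
  have hS : ∀ k, (S k).1 = {z | ∀ i < k, z i ≤ n i} := by
    intro k
    induction k with
    | zero => simp [S]
    | succ k ih =>
      have h1 : (S (k + 1)).1 = (S k).1 ∩ {z | z k ≤ n k} := rfl
      rw [h1, ih]
      ext z
      exact Nat.forall_lt_succ_right.symm
  refine ⟨Set.pi univ fun i => Iic (n i),
    isCompact_univ_pi fun i => (finite_Iic _).isCompact, ?_⟩
  by_contra! hlt
  obtain ⟨U, hKU, hUo, hU⟩ := Set.exists_isOpen_lt_of_lt _ _ hlt
  let := PiNat.metricSpaceNatNat
  obtain ⟨δ, hδ, hsub⟩ := (isCompact_univ_pi fun i => (finite_Iic (n i)).isCompact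
    ).exists_thickening_subset_open (hUo.preimage hf) (image_subset_iff.1 hKU)
  obtain ⟨k, hk⟩ := exists_pow_lt_of_lt_one hδ (by norm_num : (1 / 2 : ℝ) < 1)
  refine absurd (hU.trans (S k).2) (not_lt.2 (measure_mono (image_subset_iff.2 fun z hz => ?_)))
  rw [hS] at hz
  refine hsub (Metric.mem_thickening_iff.2 ⟨fun i => if i < k then z i else 0, ?_, ?_⟩)
  · intro i _
    by_cases hi : i < k
    · simpa [hi] using hz i hi
    · simp [hi]
  · refine lt_of_le_of_lt ?_ hk
    refine PiNat.mem_cylinder_iff_dist_le.1 fun i hi => ?_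
    simp [hi]

/-- Analytic sets are null measurable for every outer regular finite measure. -/
theorem MeasureTheory.AnalyticSet.nullMeasurableSet {X : Type*} [TopologicalSpace X] [T2Space X]
    [MeasurableSpace X] [OpensMeasurableSpace X] {A : Set X} (hA : AnalyticSet A)
    (μ : Measure X) [IsFiniteMeasure μ] [μ.OuterRegular] : NullMeasurableSet A μ := by
  rw [AnalyticSet] at hA
  obtain rfl | ⟨f, hf, rfl⟩ := hA
  · exact nullMeasurableSet_empty
  obtain h0 | h0 := eq_or_ne (μ (range f)) 0
  · exact NullMeasurableSet.of_null h0
  obtain ⟨u, -, hu, hlim⟩ := exists_seq_strictMono_tendsto' (pos_iff_ne_zero.2 h0)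
  choose K hK hle using fun i => exists_isCompact_le_measure_image μ hf (hu i).2
  have hB : MeasurableSet (⋃ i, f '' K i) :=
    MeasurableSet.iUnion fun i => ((hK i).image hf).isClosed.measurableSet
  refine hB.nullMeasurableSet.congr (ae_eq_of_subset_of_measure_ge
    (iUnion_subset fun i => image_subset_range _ _) ?_ hB.nullMeasurableSet (measure_ne_top _ _))
  exact le_of_tendsto' hlim fun i =>
    (hle i).trans (measure_mono (subset_iUnion (fun i => f '' K i) i))

theorem MeasureTheory.AnalyticSet.univMeasurableSet {X : Type*} [TopologicalSpace X]
    [PolishSpace X] [MeasurableSpace X] [BorelSpace X] {A : Set X} (hA : AnalyticSet A) :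
    UnivMeasurableSet A := by
  let := TopologicalSpace.upgradeIsCompletelyMetrizable X
  exact fun μ _ => hA.nullMeasurableSet μ

theorem UnivMeasurable.aemeasurable {X Y : Type*} [MeasurableSpace X] [MeasurableSpace Y]
    [MeasurableSpace.CountablyGenerated Y] {g : X → Y} (hg : UnivMeasurable g) (μ : Measure X)
    [IsProbabilityMeasure μ] : AEMeasurable g μ :=
  NullMeasurable.aemeasurable fun _ hs => hg hs μ inferInstance

/-- The least `k` with `x ∈ E k` depends measurably on `x`. -/
theorem measurable_sInf_mem {X : Type*} [MeasurableSpace X] {E : ℕ → Set X}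
    (hE : ∀ k, MeasurableSet (E k)) : Measurable fun x => sInf {k | x ∈ E k} := by
  refine measurable_to_countable' fun m => ?_
  have key : (fun x => sInf {k | x ∈ E k}) ⁻¹' {m} =
      (E m \ ⋃ k < m, E k) ∪ ({x | m = 0} ∩ (⋃ k, E k)ᶜ) := by
    ext x
    simp only [mem_preimage, mem_singleton_iff, mem_union, Set.mem_sdiff, mem_iUnion, not_exists,
      mem_inter_iff, mem_ofPred_eq, mem_compl_iff]
    constructor
    · rintro rfl
      by_cases hx : ({k | x ∈ E k} : Set ℕ).Nonempty
      · exact Or.inl ⟨Nat.sInf_mem hx, fun k hk => Nat.notMem_of_lt_sInf hk⟩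
      · rw [not_nonempty_iff_eq_empty] at hx
        refine Or.inr ⟨by simp [hx], fun k hk => ?_⟩
        exact (hx ▸ (show k ∈ {k | x ∈ E k} from hk) : k ∈ (∅ : Set ℕ))
    · rintro (⟨h1, h2⟩ | ⟨rfl, h⟩)
      · refine le_antisymm (Nat.sInf_le h1) (not_lt.1 fun h => h2 _ h ?_)
        exact Nat.sInf_mem (s := {k | x ∈ E k}) ⟨m, h1⟩
      · simp [h]
  rw [key]
  exact ((hE m).diff (.iUnion fun k => .iUnion fun _ => hE k)).union
    ((MeasurableSet.const _).inter (MeasurableSet.iUnion hE).compl)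

/-- **Jankov–von Neumann**: a continuous function on Baire space has a section on its range which
is measurable for every σ-algebra containing the images of the cylinders. -/
theorem exists_measurable_section {X : Type*} [TopologicalSpace X] [T2Space X]
    [MeasurableSpace X] {f : (ℕ → ℕ) → X} (hf : Continuous f)
    (hm : ∀ (n : ℕ) (l : List ℕ), MeasurableSet (f '' {z | PiNat.res z n = l})) :
    ∃ g : X → ℕ → ℕ, Measurable g ∧ ∀ x ∈ range f, f (g x) = x := by
  let next : List ℕ → X → ℕ := fun l x =>
    sInf {k | x ∈ f '' {z | PiNat.res z (l.length + 1) = k :: l}}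
  let pre : ℕ → X → List ℕ := fun n x => Nat.rec [] (fun _ l => next l x :: l) n
  have pre_succ : ∀ n x, pre (n + 1) x = next (pre n x) x :: pre n x := fun _ _ => rfl
  have hlen : ∀ n x, (pre n x).length = n := by
    intro n x
    induction n with
    | zero => rfl
    | succ n ih => rw [pre_succ, List.length_cons, ih]
  let : MeasurableSpace (List ℕ) := ⊤
  have hnext : ∀ l, Measurable (next l) := fun l => measurable_sInf_mem fun k => hm _ _
  have hnext' : Measurable fun p : List ℕ × X => next p.1 p.2 :=
    measurable_from_prod_countable_right hnext
  have hpre : ∀ n, Measurable (pre n) := by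
    intro n
    induction n with
    | zero => exact measurable_const
    | succ n ih =>
      have h1 : Measurable fun x => (next (pre n x) x, pre n x) :=
        (hnext'.comp (ih.prodMk measurable_id)).prodMk ih
      exact (measurable_of_countable fun p : ℕ × List ℕ => p.1 :: p.2).comp h1
  refine ⟨fun x n => next (pre n x) x,
    measurable_pi_lambda _ fun n => hnext'.comp ((hpre n).prodMk measurable_id), ?_⟩
  intro x hx
  have hres : ∀ n, PiNat.res (fun n => next (pre n x) x) n = pre n x := by
    intro n
    induction n with
    | zero => rfl
    | succ n ih => rw [PiNat.res_succ, ih, pre_succ]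
  have hex : ∀ n, x ∈ f '' {z | PiNat.res z n = pre n x} := by
    intro n
    induction n with
    | zero => obtain ⟨z, rfl⟩ := hx; exact ⟨z, rfl, rfl⟩
    | succ n ih =>
      obtain ⟨z, hz, hzx⟩ := ih
      have hne : ({k | x ∈ f '' {z | PiNat.res z ((pre n x).length + 1) = k :: pre n x}}).Nonempty :=
        ⟨z n, z, by rw [hlen]; exact congrArg (z n :: ·) hz, hzx⟩
      have h : x ∈ f '' {z | PiNat.res z ((pre n x).length + 1) = next (pre n x) x :: pre n x} :=
        Nat.sInf_mem hne
      rw [hlen] at h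
      rw [pre_succ]
      exact h
  choose z hz hzx using hex
  have hlim : Tendsto z atTop (𝓝 fun n => next (pre n x) x) := by
    refine tendsto_pi_nhds.2 fun i => tendsto_const_nhds.congr' ?_
    filter_upwards [eventually_gt_atTop i] with n hn
    have h2 : PiNat.res (z n) n = PiNat.res (fun n => next (pre n x) x) n :=
      (hz n).trans (hres n).symm
    exact (PiNat.res_eq_res.1 h2 hn).symm
  refine tendsto_nhds_unique ((hf.tendsto _).comp hlim) ?_
  simp only [Function.comp_def, hzx]
  exact tendsto_const_nhds

theorem exists_univMeasurable_section {X : Type*} [TopologicalSpace X] [PolishSpace X]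
    [MeasurableSpace X] [BorelSpace X] {f : (ℕ → ℕ) → X} (hf : Continuous f) :
    ∃ g : X → ℕ → ℕ, UnivMeasurable g ∧ ∀ x ∈ range f, f (g x) = x := by
  refine @exists_measurable_section X _ _ (univComp X) f hf fun n l => ?_
  refine AnalyticSet.univMeasurableSet (IsOpen.analyticSet_image ?_ hf)
  refine isOpen_iff_mem_nhds.2 fun z hz => ?_
  filter_upwards [(PiNat.isOpen_cylinder (fun _ => ℕ) z n).mem_nhds (PiNat.self_mem_cylinder z n)]
    with w hw
  rw [PiNat.cylinder_eq_res] at hw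
  exact Eq.trans hw hz

/-- Weakly continuous families of probability measures are measurable. -/
theorem Continuous.measurable_toMeasure {Y Z : Type*} [TopologicalSpace Y]
    [HasOuterApproxClosed Y] [MeasurableSpace Y] [BorelSpace Y] [TopologicalSpace Z]
    [MeasurableSpace Z] [OpensMeasurableSpace Z] {f : Z → ProbabilityMeasure Y}
    (hf : Continuous f) : Measurable fun z => (f z : Measure Y) := by
  refine .measure_of_isPiSystem_of_isProbabilityMeasure (BorelSpace.measurable_eq (α := Y))
    isPiSystem_isOpen fun s hs => LowerSemicontinuous.measurable ?_
  exact lowerSemicontinuous_iff_le_liminf.2 fun z =>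
    ProbabilityMeasure.le_liminf_measure_open_of_tendsto (hf.tendsto z) hs

/-- Pushing forward along an embedding induces the weak topology. -/
theorem Topology.IsEmbedding.isInducing_map {Y H : Type*} [TopologicalSpace Y] [MeasurableSpace Y]
    [BorelSpace Y] [HasOuterApproxClosed Y] [TopologicalSpace H] [MeasurableSpace H] [BorelSpace H]
    [TopologicalSpace.PseudoMetrizableSpace H] [TopologicalSpace.SeparableSpace H] {F : Y → H}
    (hF : IsEmbedding F) :
    IsInducing fun μ : ProbabilityMeasure Y => μ.map hF.continuous.measurable.aemeasurable := by
  refine isInducing_iff_nhds.2 fun μ => le_antisymm ?_ ?_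
  · exact (ProbabilityMeasure.continuous_map hF.continuous).tendsto μ |>.le_comap
  · suffices h : Tendsto id (comap (fun μ : ProbabilityMeasure Y =>
        μ.map hF.continuous.measurable.aemeasurable)
        (𝓝 (μ.map hF.continuous.measurable.aemeasurable))) (𝓝 μ) from tendsto_id'.1 h
    refine tendsto_of_forall_isOpen_le_liminf' fun G hG => ?_
    obtain ⟨V, hV, rfl⟩ := hF.isInducing.isOpen_iff.1 hG
    have h := ProbabilityMeasure.le_liminf_measure_open_of_tendsto
      (tendsto_comap (f := fun μ : ProbabilityMeasure Y =>
        μ.map hF.continuous.measurable.aemeasurable)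
        (x := 𝓝 (μ.map hF.continuous.measurable.aemeasurable))) hV
    simp only [ProbabilityMeasure.toMeasure_map,
      Measure.map_apply hF.continuous.measurable hV.measurableSet] at h
    exact h

/-- The probability measures on a Polish space form a continuous image of a Polish space. -/
theorem analyticSet_univ_probabilityMeasure (Y : Type*) [TopologicalSpace Y] [PolishSpace Y]
    [MeasurableSpace Y] [BorelSpace Y] : AnalyticSet (univ : Set (ProbabilityMeasure Y)) := by
  let := TopologicalSpace.upgradeIsCompletelyMetrizable Y
  obtain ⟨F, hF⟩ := Metric.PiNatEmbed.exists_embedding_to_hilbert_cube (X := Y)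
  have hFm : MeasurableEmbedding F := hF.continuous.measurableEmbedding hF.injective
  let φ : ProbabilityMeasure Y → ProbabilityMeasure (ℕ → unitInterval) :=
    fun μ => μ.map hF.continuous.measurable.aemeasurable
  have hrange : range φ = {ν : ProbabilityMeasure (ℕ → unitInterval) |
      (ν : Measure (ℕ → unitInterval)) (range F) = 1} := by
    refine Subset.antisymm ?_ fun ν hν => ?_
    · rintro _ ⟨μ, rfl⟩
      simp [φ, Measure.map_apply hFm.measurable hFm.measurableSet_range]
    · have hp : IsProbabilityMeasure ((ν : Measure (ℕ → unitInterval)).comap F) :=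
        ⟨by rw [hFm.comap_apply, image_univ]; exact hν⟩
      refine ⟨⟨_, hp⟩, Subtype.ext ?_⟩
      change Measure.map F (Measure.comap F _) = _
      rw [hFm.map_comap]
      refine Measure.restrict_eq_self_of_ae_mem ?_
      exact (mem_ae_iff_prob_eq_one hFm.measurableSet_range).2 hν
  have han : AnalyticSet (range φ) := by
    let := TopologicalSpace.metrizableSpaceMetric (ProbabilityMeasure (ℕ → unitInterval))
    let : MeasurableSpace (ProbabilityMeasure (ℕ → unitInterval)) := borel _
    have : BorelSpace (ProbabilityMeasure (ℕ → unitInterval)) := ⟨rfl⟩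
    rw [hrange]
    refine MeasurableSet.analyticSet ?_
    exact ((Measure.measurable_coe hFm.measurableSet_range).comp
      continuous_id.measurable_toMeasure) (measurableSet_singleton 1)
  obtain ⟨β, _, _, f, hf, hfr⟩ := analyticSet_iff_exists_polishSpace_range.1 han
  choose g hg using fun z => hfr ▸ mem_range_self (f := f) z
  have hgc : Continuous g := hF.isInducing_map.continuous_iff.2 ((funext hg : φ ∘ g = f) ▸ hf)
  have hgs : range g = univ := by
    refine eq_univ_of_forall fun μ => ?_
    obtain ⟨z, hz⟩ : φ μ ∈ range f := hfr ▸ mem_range_self μ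
    refine ⟨z, Subtype.ext (hFm.map_injective ?_)⟩
    exact congrArg Subtype.val ((hg z).trans hz)
  rw [← hgs]
  exact analyticSet_range_of_polishSpace hgc

theorem exists_polishSpace_surjective_probabilityMeasure (Y : Type*) [TopologicalSpace Y]
    [PolishSpace Y] [MeasurableSpace Y] [BorelSpace Y] :
    ∃ (β : Type) (_ : TopologicalSpace β) (_ : PolishSpace β) (ψ : β → ProbabilityMeasure Y),
      Continuous ψ ∧ Function.Surjective ψ := by
  obtain ⟨β, tβ, hβ, ψ, hψ, hr⟩ :=
    analyticSet_iff_exists_polishSpace_range.1 (analyticSet_univ_probabilityMeasure Y)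
  exact ⟨β, tβ, hβ, ψ, hψ, range_eq_univ.1 hr⟩

theorem MeasureTheory.AnalyticSet.inter {X : Type*} [TopologicalSpace X] [T2Space X] {s t : Set X}
    (hs : AnalyticSet s) (ht : AnalyticSet t) : AnalyticSet (s ∩ t) := by
  rw [inter_eq_iInter]
  exact AnalyticSet.iInter fun b => by cases b <;> assumption

theorem MeasureTheory.AnalyticSet.preimage_of_measurable {X Y : Type*} [tX : TopologicalSpace X]
    [PolishSpace X] [MeasurableSpace X] [BorelSpace X] [TopologicalSpace Y] [T2Space Y]
    [SecondCountableTopology Y] [MeasurableSpace Y] [OpensMeasurableSpace Y] {A : Set Y}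
    (hA : AnalyticSet A) {f : X → Y} (hf : Measurable f) : AnalyticSet (f ⁻¹' A) := by
  obtain ⟨t', hle, hcont, hpol⟩ := hf.exists_continuous
  have h := @AnalyticSet.preimage X Y t' _ hpol _ A hA f hcont
  simpa only [image_id] using
    @AnalyticSet.image_of_continuous X t' X tX _ h id (continuous_id_of_le hle)

/-- If `A` is analytic, the set of parameters `x` for which `A_x` has full measure under the
kernel `κ x` is analytic. -/
theorem MeasureTheory.AnalyticSet.setOf_ae_mem {X Y : Type*} [TopologicalSpace X] [PolishSpace X]
    [MeasurableSpace X] [BorelSpace X] [TopologicalSpace Y] [PolishSpace Y] [MeasurableSpace Y]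
    [BorelSpace Y] (κ : Kernel X Y) [IsMarkovKernel κ] {A : Set (X × Y)} (hA : AnalyticSet A) :
    AnalyticSet {x | ∀ᵐ y ∂κ x, (x, y) ∈ A} := by
  have hA' := hA
  rw [AnalyticSet] at hA'
  obtain rfl | ⟨h, hh, hr⟩ := hA'
  · convert! analyticSet_empty (α := X)
    simp [IsProbabilityMeasure.ne_zero]
  obtain ⟨β, _, _, ψ, hψ, hsurj⟩ := exists_polishSpace_surjective_probabilityMeasure (ℕ → ℕ)
  borelize β
  let H : Kernel (X × β) (ℕ → ℕ) :=
    ⟨fun p => ψ p.2, hψ.measurable_toMeasure.comp measurable_snd⟩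
  have : IsMarkovKernel H :=
    ⟨fun p => inferInstanceAs (IsProbabilityMeasure (ψ p.2 : Measure (ℕ → ℕ)))⟩
  have hk : Measurable fun z => (h z).2 := (continuous_snd.comp hh).measurable
  have hM1 : MeasurableSet {p : X × β |
      κ p.1 ≪ (ψ p.2 : Measure (ℕ → ℕ)).map fun z => (h z).2} := by
    have := Kernel.measurableSet_absolutelyContinuous (κ.comap Prod.fst measurable_fst)
      (H.map fun z => (h z).2)
    simp only [Kernel.comap_apply, Kernel.map_apply _ hk] at this
    exact this
  have hD : MeasurableSet {q : (X × β) × (ℕ → ℕ) | (h q.2).1 ≠ q.1.1} :=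
    (isClosed_eq (by fun_prop) (by fun_prop)).measurableSet.compl
  have hM2 : MeasurableSet {p : X × β | (ψ p.2 : Measure (ℕ → ℕ)) {z | (h z).1 ≠ p.1} = 0} :=
    Kernel.measurable_kernel_prodMk_left (κ := H) hD (measurableSet_singleton 0)
  convert! (hM1.inter hM2).analyticSet.image_of_continuous continuous_fst
  ext x
  simp only [mem_ofPred_eq, mem_image, mem_inter_iff, Prod.exists, exists_and_right,
    exists_eq_right]
  let := TopologicalSpace.upgradeIsCompletelyMetrizable X
  let := TopologicalSpace.upgradeIsCompletelyMetrizable Y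
  constructor
  · intro hx
    obtain ⟨g, hg, hgs⟩ := exists_univMeasurable_section hh
    have : IsProbabilityMeasure ((κ x).map (Prod.mk x)) :=
      Measure.isProbabilityMeasure_map measurable_prodMk_left.aemeasurable
    have hgm := hg.aemeasurable ((κ x).map (Prod.mk x))
    have : IsProbabilityMeasure (((κ x).map (Prod.mk x)).map g) :=
      Measure.isProbabilityMeasure_map hgm
    have hmA : ∀ᵐ p ∂(κ x).map (Prod.mk x), h (g p) = p := by
      have : ∀ᵐ p ∂(κ x).map (Prod.mk x), p ∈ A := by
        rw [ae_iff]
        change (Measure.map _ _) Aᶜ = 0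
        rw [Measure.map_apply₀ measurable_prodMk_left.aemeasurable (hA.nullMeasurableSet _).compl]
        exact hx
      filter_upwards [this] with p hp
      exact hgs p (hr ▸ hp)
    have hmx : ∀ᵐ p ∂(κ x).map (Prod.mk x), p.1 = x := by
      rw [ae_map_iff measurable_prodMk_left.aemeasurable
        (measurableSet_eq_fun measurable_fst measurable_const)]
      simp
    obtain ⟨b, hb⟩ := hsurj ⟨_, this⟩
    refine ⟨b, ?_, ?_⟩
    · rw [hb]
      change κ x ≪ (((κ x).map (Prod.mk x)).map g).map _
      rw [AEMeasurable.map_map_of_aemeasurable hk.aemeasurable hgm,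
        Measure.map_congr (g := Prod.snd) (by filter_upwards [hmA] with p hp; simp [hp]),
        Measure.map_map measurable_snd measurable_prodMk_left]
      simp [Function.comp_def, Measure.AbsolutelyContinuous.rfl]
    · rw [hb]
      change (((κ x).map (Prod.mk x)).map g) _ = 0
      have hms : MeasurableSet {z | (h z).1 ≠ x} :=
        (isClosed_eq (by fun_prop) continuous_const).measurableSet.compl
      rw [Measure.map_apply_of_aemeasurable hgm hms]
      refine measure_eq_zero_iff_ae_notMem.2 ?_
      filter_upwards [hmA, hmx] with p hp hpx
      simp [hp, hpx]
  · rintro ⟨b, hac, h0⟩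
    refine hac.ae_le ?_
    have hAx : AnalyticSet {y | (x, y) ∈ A} := hA.preimage (Continuous.prodMk_right x)
    change (Measure.map _ _) {y | (x, y) ∈ A}ᶜ = 0
    rw [Measure.map_apply₀ hk.aemeasurable (hAx.nullMeasurableSet _).compl]
    refine measure_mono_null (fun z hz (hzx : (h z).1 = x) => hz ?_) h0
    change (x, (h z).2) ∈ A
    rw [← hr, ← hzx]
    exact mem_range_self z

/-- The pointwise interior of a convex-valued map with analytic graph has analytic graph. -/
theorem MeasureTheory.AnalyticSet.graph_interior {X : Type*} [TopologicalSpace X] [PolishSpace X]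
    {d : ℕ} {C : X → Set (Fin d → ℝ)} (hC : ∀ x, Convex ℝ (C x))
    (hA : AnalyticSet {q : X × (Fin d → ℝ) | q.2 ∈ C q.1}) :
    AnalyticSet {q : X × (Fin d → ℝ) | q.2 ∈ interior (C q.1)} := by
  let v : (Fin d → ℚ × ℚ) → (Fin d → Bool) → Fin d → ℝ :=
    fun r s i => if s i then ((r i).2 : ℝ) else ((r i).1 : ℝ)
  have key : {q : X × (Fin d → ℝ) | q.2 ∈ interior (C q.1)} =
      ⋃ r : Fin d → ℚ × ℚ, ((⋂ s : Fin d → Bool, (fun q => (q.1, v r s)) ⁻¹'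
        {q : X × (Fin d → ℝ) | q.2 ∈ C q.1}) ∩
        Prod.snd ⁻¹' Set.pi univ fun i => Ioo ((r i).1 : ℝ) (r i).2) := by
    ext ⟨x, y⟩
    simp only [mem_ofPred_eq, mem_iUnion, mem_inter_iff, mem_iInter, mem_preimage]
    constructor
    · intro hy
      obtain ⟨ε, hε, hball⟩ := Metric.mem_nhds_iff.1 (mem_interior_iff_mem_nhds.1 hy)
      choose a ha using fun i => exists_rat_btwn (sub_lt_self (y i) hε)
      choose b hb using fun i => exists_rat_btwn (lt_add_of_pos_right (y i) hε)
      refine ⟨fun i => (a i, b i), fun s => hball ?_, fun i _ => ⟨(ha i).2, (hb i).1⟩⟩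
      refine (dist_pi_lt_iff hε).2 fun i => ?_
      rw [Real.dist_eq, abs_lt]
      have := ha i
      have := hb i
      by_cases hs : s i <;> simp only [v, hs] <;> constructor <;> simp <;> linarith
    · rintro ⟨r, hv, hy⟩
      have hsub : (Set.pi univ fun i => ({((r i).1 : ℝ), ((r i).2 : ℝ)} : Set ℝ)) ⊆ C x := by
        intro w hw
        classical
        convert! hv fun i => decide (w i = (r i).2)
        ext i
        have := hw i trivial
        by_cases hi : w i = (r i).2
        · simp [v, hi]
        · simpa [v, hi] using this
      have hhull := (hC x).convexHull_subset_iff.2 hsub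
      rw [convexHull_pi] at hhull
      refine interior_maximal ?_ (isOpen_set_pi finite_univ fun i _ => isOpen_Ioo) hy
      refine (Set.pi_mono fun i _ => ?_).trans hhull
      rw [convexHull_pair]
      exact Ioo_subset_Icc_self.trans Icc_subset_segment
  rw [key]
  refine AnalyticSet.iUnion fun r => AnalyticSet.inter (AnalyticSet.iInter fun s => ?_) ?_
  · exact hA.preimage (by fun_prop)
  · have := ((isOpen_set_pi finite_univ fun i _ =>
      (isOpen_Ioo : IsOpen (Ioo ((r i).1 : ℝ) (r i).2))).preimage
      (continuous_snd : Continuous (Prod.snd : X × (Fin d → ℝ) → _))).analyticSet_image continuous_id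
    simpa only [image_id] using this

end Suslin

section

open ProbabilityTheory

/-- The set-valued map `Ξ_t` has analytic graph. -/
theorem analyticSet_graph_XiSCPS {Ω₁ : Type*} [TopologicalSpace Ω₁] [PolishSpace Ω₁]
    [MeasurableSpace Ω₁] [BorelSpace Ω₁] {t d : ℕ}
    {𝒬t : (Fin t → Ω₁) → Set (ProbabilityMeasure Ω₁)}
    (h𝒬graph : AnalyticSet {p : (Fin t → Ω₁) × ProbabilityMeasure Ω₁ | p.2 ∈ 𝒬t p.1})
    {Pker : (Fin t → Ω₁) → ProbabilityMeasure Ω₁}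
    (hPker : Measurable fun ω => (Pker ω : Measure Ω₁))
    {Z : (Fin t → Ω₁) → Fin d → ℝ} (hZ : Measurable Z)
    {Kt1star : (Fin t → Ω₁) × Ω₁ → Set (Fin d → ℝ)}
    (hconv : ∀ p, Convex ℝ (Kt1star p))
    (hgraph : AnalyticSet {q : ((Fin t → Ω₁) × Ω₁) × (Fin d → ℝ) | q.2 ∈ Kt1star q.1}) :
    AnalyticSet {p : (Fin t → Ω₁) ×
        (ProbabilityMeasure Ω₁ × (Fin d → ProbabilityMeasure Ω₁) × ProbabilityMeasure Ω₁) |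
        p.2 ∈ XiSCPS 𝒬t Pker Z Kt1star p.1} := by
  obtain ⟨β, _, _, ψ, hψ, hsurj⟩ := exists_polishSpace_surjective_probabilityMeasure Ω₁
  borelize β
  let X := (Fin t → Ω₁) × β × (Fin d → β) × β
  let Ψ : X → (Fin t → Ω₁) ×
      (ProbabilityMeasure Ω₁ × (Fin d → ProbabilityMeasure Ω₁) × ProbabilityMeasure Ω₁) :=
    fun x => (x.1, ψ x.2.1, fun i => ψ (x.2.2.1 i), ψ x.2.2.2)
  have hΨ : Continuous Ψ := by fun_prop
  have hΨs : Function.Surjective Ψ := by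
    rintro ⟨ω, q, m, p⟩
    obtain ⟨a, rfl⟩ := hsurj q
    obtain ⟨c, rfl⟩ := hsurj p
    choose b hb using fun i => hsurj (m i)
    exact ⟨(ω, a, b, c), by simp only [Ψ, hb]⟩
  let κ : (f : X → ProbabilityMeasure Ω₁) → (Measurable fun x => (f x : Measure Ω₁)) →
      Kernel X Ω₁ := fun f hf => ⟨fun x => f x, hf⟩
  have hκ : ∀ f hf, IsMarkovKernel (κ f hf) := fun f hf =>
    ⟨fun x => inferInstanceAs (IsProbabilityMeasure (f x : Measure Ω₁))⟩
  let κP := κ (fun x => Pker x.1) (hPker.comp measurable_fst)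
  let κQ := κ (fun x => ψ x.2.1) (Continuous.measurable_toMeasure (by fun_prop))
  let κμ := fun i => κ (fun x => ψ (x.2.2.1 i)) (Continuous.measurable_toMeasure (by fun_prop))
  let κS := κ (fun x => ψ x.2.2.2) (Continuous.measurable_toMeasure (by fun_prop))
  have hM : MeasurableSet {x : X | κP x ≪ κQ x ∧ (∀ i, κQ x ≪ κμ i x ∧ κμ i x ≪ κQ x) ∧
      ∀ i, κμ i x ≪ κS x} := by
    simp only [ofPred_and, ofPred_forall]
    exact (Kernel.measurableSet_absolutelyContinuous κP κQ).inter
      ((MeasurableSet.iInter fun i => (Kernel.measurableSet_absolutelyContinuous κQ (κμ i)).inter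
        (Kernel.measurableSet_absolutelyContinuous (κμ i) κQ)).inter
      (MeasurableSet.iInter fun i => Kernel.measurableSet_absolutelyContinuous (κμ i) κS))
  have hD : Measurable fun y : X × Ω₁ =>
      ((y.1.1, y.2), fun i => Z y.1.1 i * (Kernel.rnDeriv (κμ i) κQ y.1 y.2).toReal) := by
    refine ((measurable_fst.comp measurable_fst).prodMk measurable_snd).prodMk
      (measurable_pi_lambda _ fun i => ?_)
    exact ((measurable_pi_apply i).comp (hZ.comp (measurable_fst.comp measurable_fst))).mul
      (Kernel.measurable_rnDeriv (κμ i) κQ).ennreal_toReal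
  have hA := ((hgraph.graph_interior hconv).preimage_of_measurable hD).setOf_ae_mem κQ
  have h𝒬 := h𝒬graph.preimage (f := fun x : X => (x.1, ψ x.2.2.2)) (by fun_prop)
  rw [← image_preimage_eq {p : (Fin t → Ω₁) × _ | p.2 ∈ XiSCPS 𝒬t Pker Z Kt1star p.1} hΨs]
  refine AnalyticSet.image_of_continuous ?_ hΨ
  convert! h𝒬.inter (hM.analyticSet.inter hA)
  ext x
  have hder : ∀ᵐ ω' ∂κQ x, ∀ i, Kernel.rnDeriv (κμ i) κQ x ω' = (κμ i x).rnDeriv (κQ x) ω' :=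
    ae_all_iff.2 fun i => Kernel.rnDeriv_eq_rnDeriv_measure
  have hiff : (∀ᵐ ω' ∂κQ x, (fun i => Z x.1 i * ((κμ i x).rnDeriv (κQ x) ω').toReal) ∈
      interior (Kt1star (x.1, ω'))) ↔ ∀ᵐ ω' ∂κQ x, (fun i => Z x.1 i *
        (Kernel.rnDeriv (κμ i) κQ x ω').toReal) ∈ interior (Kt1star (x.1, ω')) := by
    refine Filter.eventually_congr ?_
    filter_upwards [hder] with ω' h
    simp only [h]
  change (_ ∧ _ ∧ _ ∧ _ ∧ (∀ᵐ ω' ∂κQ x, (fun i => Z x.1 i *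
    ((κμ i x).rnDeriv (κQ x) ω').toReal) ∈ interior (Kt1star (x.1, ω')))) ↔
    _ ∧ (_ ∧ _ ∧ _) ∧ ∀ᵐ ω' ∂κQ x, (fun i => Z x.1 i *
        (Kernel.rnDeriv (κμ i) κQ x ω').toReal) ∈ interior (Kt1star (x.1, ω'))
  rw [← hiff]
  exact ⟨fun ⟨a, b, c, d, e⟩ => ⟨a, ⟨b, c, d⟩, e⟩, fun ⟨a, ⟨b, c, d⟩, e⟩ => ⟨a, b, c, d, e⟩⟩

theorem Measurable.univMeasurable {X Y : Type*} [MeasurableSpace X] [MeasurableSpace Y]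
    {f : X → Y} (hf : Measurable f) : UnivMeasurable f :=
  fun _ hs _ _ => (hf hs).nullMeasurableSet

theorem Measurable.comp_univMeasurable {X Y W : Type*} [MeasurableSpace X] [MeasurableSpace Y]
    [MeasurableSpace W] {f : Y → W} {g : X → Y} (hf : Measurable f) (hg : UnivMeasurable g) :
    UnivMeasurable fun x => f (g x) :=
  fun _ hs => hg (hf hs)

end

/-- Lemma 5.13. `Ξ_t` has analytic graph and admits universally measurable
selectors `Q, μ, P̂` on the universally measurable set `{Ξ_t ≠ ∅}`. -/
theorem measurable_selection_SCPS {Ω₁ : Type*} [TopologicalSpace Ω₁] [PolishSpace Ω₁]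
    [MeasurableSpace Ω₁] [BorelSpace Ω₁] (t d : ℕ)
    (𝒬t : (Fin t → Ω₁) → Set (ProbabilityMeasure Ω₁))
    (h𝒬ne : ∀ ω, (𝒬t ω).Nonempty) (h𝒬conv : ∀ ω, ConvexProb (𝒬t ω))
    (h𝒬graph : AnalyticSet {p : (Fin t → Ω₁) × ProbabilityMeasure Ω₁ | p.2 ∈ 𝒬t p.1})
    (Pker : (Fin t → Ω₁) → ProbabilityMeasure Ω₁)
    (hPker : Measurable fun ω => (Pker ω : Measure Ω₁))
    (Z : (Fin t → Ω₁) → Fin d → ℝ) (hZ : Measurable Z)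
    (Kt1star : (Fin t → Ω₁) × Ω₁ → Set (Fin d → ℝ))
    (hne : ∀ p, (Kt1star p).Nonempty) (hcl : ∀ p, IsClosed (Kt1star p))
    (hconv : ∀ p, Convex ℝ (Kt1star p))
    (hcone : ∀ p, ∀ c : ℝ, 0 ≤ c → ∀ x ∈ Kt1star p, c • x ∈ Kt1star p)
    (hgraph : AnalyticSet {q : ((Fin t → Ω₁) × Ω₁) × (Fin d → ℝ) | q.2 ∈ Kt1star q.1}) :
    AnalyticSet {p : (Fin t → Ω₁) ×
        (ProbabilityMeasure Ω₁ × (Fin d → ProbabilityMeasure Ω₁) × ProbabilityMeasure Ω₁) |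
        p.2 ∈ XiSCPS 𝒬t Pker Z Kt1star p.1} ∧
    UnivMeasurableSet {ω | (XiSCPS 𝒬t Pker Z Kt1star ω).Nonempty} ∧
    ∃ (Q : (Fin t → Ω₁) → ProbabilityMeasure Ω₁)
      (μv : (Fin t → Ω₁) → Fin d → ProbabilityMeasure Ω₁)
      (Ph : (Fin t → Ω₁) → ProbabilityMeasure Ω₁),
      UnivMeasurable (fun ω => (Q ω : Measure Ω₁)) ∧
      (∀ i, UnivMeasurable (fun ω => (μv ω i : Measure Ω₁))) ∧
      UnivMeasurable (fun ω => (Ph ω : Measure Ω₁)) ∧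
      ∀ ω, (XiSCPS 𝒬t Pker Z Kt1star ω).Nonempty →
        (Q ω, μv ω, Ph ω) ∈ XiSCPS 𝒬t Pker Z Kt1star ω := by
  have hG := analyticSet_graph_XiSCPS h𝒬graph hPker hZ hconv hgraph
  refine ⟨hG, ?_⟩
  have hdom : {ω | (XiSCPS 𝒬t Pker Z Kt1star ω).Nonempty} = Prod.fst '' {p : (Fin t → Ω₁) ×
      (ProbabilityMeasure Ω₁ × (Fin d → ProbabilityMeasure Ω₁) × ProbabilityMeasure Ω₁) |
      p.2 ∈ XiSCPS 𝒬t Pker Z Kt1star p.1} := by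
    ext ω
    exact ⟨fun ⟨q, hq⟩ => ⟨(ω, q), hq, rfl⟩, by rintro ⟨p, hp, rfl⟩; exact ⟨p.2, hp⟩⟩
  refine ⟨hdom ▸ (hG.image_of_continuous continuous_fst).univMeasurableSet, ?_⟩
  rw [AnalyticSet] at hG
  obtain h0 | ⟨h, hh, hr⟩ := hG
  · refine ⟨Pker, fun ω _ => Pker ω, Pker, hPker.univMeasurable, fun _ => hPker.univMeasurable,
      hPker.univMeasurable, fun ω hω => ?_⟩
    rw [h0, image_empty] at hdom
    exact absurd (hdom.subset hω) (notMem_empty ω)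
  have hQ : Measurable fun z => ((h z).2.1 : Measure Ω₁) :=
    Continuous.measurable_toMeasure (by fun_prop)
  have hμ : ∀ i, Measurable fun z => ((h z).2.2.1 i : Measure Ω₁) := fun i =>
    Continuous.measurable_toMeasure (by fun_prop)
  have hS : Measurable fun z => ((h z).2.2.2 : Measure Ω₁) :=
    Continuous.measurable_toMeasure (by fun_prop)
  obtain ⟨g, hg, hgs⟩ := exists_univMeasurable_section (continuous_fst.comp hh)
  refine ⟨fun ω => (h (g ω)).2.1, fun ω => (h (g ω)).2.2.1, fun ω => (h (g ω)).2.2.2,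
    hQ.comp_univMeasurable hg, fun i => (hμ i).comp_univMeasurable hg,
    hS.comp_univMeasurable hg, fun ω hω => ?_⟩
  have hmem : ω ∈ range (Prod.fst ∘ h) := by
    rw [range_comp, hr, ← hdom]
    exact hω
  have hsel : (h (g ω)).2 ∈ XiSCPS 𝒬t Pker Z Kt1star (h (g ω)).1 := hr.subset (mem_range_self _)
  rwa [show (h (g ω)).1 = ω from hgs ω hmem] at hsel
end
end
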